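/- Every finite near-comparability graph is permissible: if a finite simple graph G admits an orientation in which every vertex is near-transitive, then G has a permis, i.e. a permutation w of its vertex set such that MIS^w(x) is the characteristic vector of a maximal independent set of G for every configuration x. -/

import Mathlib

variable {V : Type*}

/-- One sequential update of the MIS network at vertex `v`:
the state of `v` becomes `1` iff all its neighbours are in state `0`. -/
def misStep [DecidableEq V] (G : SimpleGraph V) (x : V → Prop) (v : V) : V → Prop :=
  Function.update x v (∀ u, G.Adj u v → ¬ x u)

/-- Sequential updates of the MIS network along the word `w` (first letter updated first). -/
def misWord [DecidableEq V] (G : SimpleGraph V) (w : List V) (x : V → Prop) : V → Prop :=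
  w.foldl (misStep G) x

/-- `S` is an independent set of `G`. -/
def IsIndepSet {W : Type*} (G : SimpleGraph W) (S : Set W) : Prop :=
  ∀ ⦃u⦄, u ∈ S → ∀ ⦃v⦄, v ∈ S → ¬ G.Adj u v

/-- `S` is a maximal independent set of `G`. -/
def IsMaxIndepSet {W : Type*} (G : SimpleGraph W) (S : Set W) : Prop :=
  IsIndepSet G S ∧ ∀ T, IsIndepSet G T → S ⊆ T → T = S

/-- `r` is an orientation of `G`: every arc of `r` is an edge of `G`, and every edge
of `G` gets exactly one of its two possible directions. -/
def IsOrientation {W : Type*} (G : SimpleGraph W) (r : W → W → Prop) : Prop :=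
  (∀ u v, r u v → G.Adj u v) ∧ (∀ u v, G.Adj u v → (r u v ↔ ¬ r v u))

/-- The vertex `t` is transitive in the orientation `r`. -/
def TransitiveVertex {W : Type*} (r : W → W → Prop) (t : W) : Prop :=
  ∀ a b, r t a → r a b → r t b

/-- The vertex `v` is near-transitive in the orientation `r` of `G`: some transitive
vertex `t` satisfies `N[t] ⊆ N[v]` (closed neighbourhoods in `G`). -/
def NearTransitiveVertex {W : Type*} (G : SimpleGraph W) (r : W → W → Prop) (v : W) : Prop :=
  ∃ t, TransitiveVertex r t ∧ insert t (G.neighborSet t) ⊆ insert v (G.neighborSet v)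

/-- The vertex `m` is a benjamin of `G`: no closed neighbourhood is strictly contained
in that of `m`. -/
def Benjamin {W : Type*} (G : SimpleGraph W) (m : W) : Prop :=
  ¬ ∃ v, insert v (G.neighborSet v) ⊂ insert m (G.neighborSet m)

theorem misWord_notMem [DecidableEq V] (G : SimpleGraph V) (l : List V) (x : V → Prop) (v : V)
    (h : v ∉ l) : misWord G l x v = x v := by
  induction l generalizing x with
  | nil => rfl
  | cons a l ih =>
    simp only [List.mem_cons, not_or] at h
    have := ih (misStep G x a) h.2
    simp only [misWord, List.foldl_cons] at this ⊢
    rw [this, misStep, Function.update_of_ne h.1]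

theorem misWord_append [DecidableEq V] (G : SimpleGraph V) (l m : List V) (x : V → Prop) :
    misWord G (l ++ m) x = misWord G m (misWord G l x) := by
  simp [misWord]

theorem misWord_split [DecidableEq V] (G : SimpleGraph V) (l m : List V) (x : V → Prop) (v : V)
    (h : (l ++ v :: m).Nodup) :
    misWord G (l ++ v :: m) x v ↔ ∀ u, G.Adj u v →
      (u ∈ l → ¬ misWord G (l ++ v :: m) x u) ∧ (u ∉ l → ¬ x u) := by
  have hv : v ∉ m := by
    have := h.of_append_right
    simp at this
    exact this.1
  have e : misWord G (l ++ v :: m) x v ↔ ∀ u, G.Adj u v → ¬ misWord G l x u := by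
    rw [misWord_append]
    change misWord G m (misStep G (misWord G l x) v) v ↔ _
    rw [misWord_notMem G m _ v hv]
    simp [misStep]
  rw [e]
  refine forall_congr' fun u => forall_congr' fun hu => ?_
  by_cases hl : u ∈ l
  · have h2 : u ∉ v :: m := fun h3 => (List.nodup_append.1 h).2.2 u hl u h3 rfl
    rw [misWord_append, misWord_notMem G (v :: m) _ u h2]
    simp [hl]
  · rw [misWord_notMem G l _ u hl]
    simp [hl]

theorem misWord_iff [DecidableEq V] (G : SimpleGraph V) (w : List V) (x : V → Prop)
    (h : w.Nodup) (hw : ∀ v, v ∈ w) (v : V) :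
    misWord G w x v ↔ ∀ u, G.Adj u v →
      (w.idxOf u < w.idxOf v → ¬ misWord G w x u) ∧ (w.idxOf v < w.idxOf u → ¬ x u) := by
  obtain ⟨l, m, rfl⟩ := List.append_of_mem (hw v)
  rw [misWord_split G l m x v h]
  have hv : v ∉ l := fun h3 => (List.nodup_append.1 h).2.2 v h3 v (by simp) rfl
  refine forall_congr' fun u => forall_congr' fun hu => ?_
  have hne : u ≠ v := hu.ne
  have hiv : (l ++ v :: m).idxOf v = l.length := by
    simp [List.idxOf_append, hv]
  by_cases hl : u ∈ l
  · have : (l ++ v :: m).idxOf u < l.length := by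
      simp [List.idxOf_append, hl, List.idxOf_lt_length_iff]
    rw [hiv]
    simp [hl, this, this.le]
  · have : l.length < (l ++ v :: m).idxOf u := by
      simp [List.idxOf_append, hl, List.idxOf_cons_ne _ hne.symm]
    rw [hiv]
    simp [hl, this, this.le]

theorem mis_dominates [Fintype V] (G : SimpleGraph V) (pos : V → ℕ)
    (x y : V → Prop)
    (hy : ∀ v, y v ↔ ∀ u, G.Adj u v → (pos u < pos v → ¬ y u) ∧ (pos v < pos u → ¬ x u))
    (t : V) (ht : ∀ u z, G.Adj t u → G.Adj u z → pos t < pos u → pos u < pos z → G.Adj t z) :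
    ∃ z, (z = t ∨ G.Adj t z) ∧ y z := by
  classical
  by_contra! hc
  have h0 : ¬ y t := hc t (Or.inl rfl)
  rw [hy] at h0
  push Not at h0
  obtain ⟨u, hut, hu⟩ := h0
  have hne : (Finset.univ.filter fun u => G.Adj t u ∧ pos t < pos u ∧ x u).Nonempty := by
    refine ⟨u, Finset.mem_filter.2 ⟨Finset.mem_univ _, ?_⟩⟩
    refine ⟨hut.symm, ?_⟩
    by_cases h1 : pos u < pos t ∧ y u
    · exact absurd h1.2 (hc u (Or.inr hut.symm))
    · exact hu (fun h2 h3 => h1 ⟨h2, h3⟩)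
  obtain ⟨m, hm, hmax⟩ := Finset.exists_max_image _ pos hne
  simp only [Finset.mem_filter, Finset.mem_univ, true_and] at hm hmax
  have h1 : ¬ y m := hc m (Or.inr hm.1)
  rw [hy] at h1
  push Not at h1
  obtain ⟨z, hz, hz2⟩ := h1
  by_cases h3 : pos z < pos m ∧ y z
  · exact (((hy z).1 h3.2) m hz.symm).2 h3.1 hm.2.2
  · obtain ⟨h4, h5⟩ := hz2 (fun a b => h3 ⟨a, b⟩)
    have := hmax z ⟨ht m z hm.1 hz.symm hm.2.1 h4, by omega, h5⟩
    omega

theorem transitive_reach {r : V → V → Prop} {t a b : V} (ht : TransitiveVertex r t)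
    (h : r t a) (hab : Relation.ReflTransGen r a b) : r t b := by
  induction hab with
  | refl => exact h
  | tail _ h2 ih => exact ht _ _ ih h2

/-- Every finite near-comparability graph is permissible: if `G` admits an orientation
in which every vertex is near-transitive, then `G` has a permis, i.e. a permutation
`w` of its vertex set such that `MIS^w(x)` is the characteristic vector of a maximal
independent set of `G` for every configuration `x`. -/
theorem stmt_11 [DecidableEq V] [Fintype V] (G : SimpleGraph V)
    (h : ∃ r : V → V → Prop, IsOrientation G r ∧ ∀ v, NearTransitiveVertex G r v) :
    ∃ w : List V, w.Nodup ∧ (∀ v : V, v ∈ w) ∧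
      ∀ x : V → Prop, IsMaxIndepSet G {v | misWord G w x v} := by
  classical
  obtain ⟨r, ⟨hr1, hr2⟩, hnt⟩ := h
  let R : V → Finset V := fun v => Finset.univ.filter fun u => Relation.ReflTransGen r v u
  have hsub : ∀ a b, r a b → R b ⊆ R a := by
    intro a b hab c hc
    simp only [R, Finset.mem_filter, Finset.mem_univ, true_and] at hc ⊢
    exact Relation.ReflTransGen.head hab hc
  let w : List V := (Finset.univ : Finset V).toList.insertionSort fun a b => (R b).card ≤ (R a).card
  have hperm : w.Perm (Finset.univ : Finset V).toList := List.perm_insertionSort _ _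
  have hnd : w.Nodup := hperm.nodup_iff.2 (Finset.nodup_toList _)
  have hmem : ∀ v, v ∈ w := fun v => hperm.mem_iff.2 (by simp)
  have hsort : w.Pairwise fun a b => (R b).card ≤ (R a).card := by
    have : Std.Total fun a b : V => (R b).card ≤ (R a).card := ⟨fun a b => le_total _ _⟩
    have : IsTrans V fun a b : V => (R b).card ≤ (R a).card := ⟨fun a b c h1 h2 => h2.trans h1⟩
    exact List.pairwise_insertionSort _ _
  have hpos : ∀ a b, w.idxOf a < w.idxOf b → (R b).card ≤ (R a).card := by
    intro a b hab
    have := List.pairwise_iff_getElem.1 hsort _ _ (List.idxOf_lt_length_iff.2 (hmem a))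
      (List.idxOf_lt_length_iff.2 (hmem b)) hab
    simpa using this
  refine ⟨w, hnd, hmem, fun x => ?_⟩
  have hy := misWord_iff G w x hnd hmem
  have hind : IsIndepSet G {v | misWord G w x v} := by
    intro u hu v hv huv
    rcases lt_trichotomy (w.idxOf u) (w.idxOf v) with h | h | h
    · exact ((hy v).1 hv u huv).1 h hu
    · exact huv.ne ((List.idxOf_inj (hmem u)).1 h)
    · exact ((hy u).1 hu v huv.symm).1 h hv
  have key : ∀ t, TransitiveVertex r t → ∀ u z, G.Adj t u → G.Adj u z →
      w.idxOf t < w.idxOf u → w.idxOf u < w.idxOf z → G.Adj t z := by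
    intro t ht u z htu huz h1 h2
    have hback : ∀ a b, G.Adj a b → w.idxOf a < w.idxOf b → Relation.ReflTransGen r a b := by
      intro a b hab hlt
      by_cases h : r a b
      · exact Relation.ReflTransGen.single h
      · have hba : r b a := by
          by_contra h'
          exact h ((hr2 a b hab).2 h')
        have heq := Finset.eq_of_subset_of_card_le (hsub b a hba) (hpos a b hlt)
        have : b ∈ R b := by simp [R, Relation.ReflTransGen.refl]
        rw [← heq] at this
        simpa [R] using this
    have htu' : r t u := by
      rcases Relation.ReflTransGen.cases_head (hback t u htu h1) with h | ⟨c, hc, hcu⟩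
      · exact absurd h htu.ne
      · exact transitive_reach ht hc hcu
    exact hr1 _ _ (transitive_reach ht htu' (hback u z huz h2))
  refine ⟨hind, fun T hT hST => Set.Subset.antisymm (fun v hv => ?_) hST⟩
  obtain ⟨t, ht, hN⟩ := hnt v
  obtain ⟨z, hz, hyz⟩ := mis_dominates G (fun v => w.idxOf v) x _ hy t (key t ht)
  have hz' : z ∈ insert v (G.neighborSet v) := hN (by simpa using hz)
  rcases hz' with rfl | hz'
  · exact hyz
  · exact absurd hz' (hT hv (hST hyz))
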